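/- arXiv:2102.10156 — 5 statements merged into one kernel-verified Lean document; each statement's English description precedes it below -/
import Mathlib

section
/- Per-round loss of the RAI rule (deterministic core of the regret bound): assume the regularity condition with constant D > 0 and let p0 > 0. Let μ* ∈ Δ(Ω) with min_ω μ*(ω) ≥ p0, let ε ≥ 0, and let γ ∈ Δ(Ω) with ‖μ* − γ‖₁ ≤ ε. If σ maximizes V(γ, ·) over Pers(B₁(γ, ε)), then OPT(μ*) − V(μ*, σ) ≤ (20/(p0²·D) + 1)·ε. Moreover σ ∈ Pers(μ*). -/
/-- A probability distribution on a finite set `Ω`, viewed as a function `Ω → ℝ`. -/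
def IsDist {Ω : Type*} [Fintype Ω] (μ : Ω → ℝ) : Prop :=
  (∀ ω, 0 ≤ μ ω) ∧ ∑ ω, μ ω = 1

/-- A signaling mechanism: `σ ω` is a distribution over actions for each state `ω`. -/
def IsMech {Ω A : Type*} [Fintype A] (σ : Ω → A → ℝ) : Prop :=
  ∀ ω, IsDist (σ ω)

/-- The obedience (persuasiveness) constraints for the prior `μ`. -/
def Pers {Ω A : Type*} [Fintype Ω] (u : Ω → A → ℝ) (μ : Ω → ℝ) (σ : Ω → A → ℝ) : Prop :=
  ∀ a a' : A, 0 ≤ ∑ ω, μ ω * σ ω a * (u ω a - u ω a')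

/-- Persuasiveness simultaneously for all priors in a set `B`. -/
def PersOn {Ω A : Type*} [Fintype Ω] (u : Ω → A → ℝ) (B : Set (Ω → ℝ)) (σ : Ω → A → ℝ) : Prop :=
  ∀ μ ∈ B, Pers u μ σ

/-- The sender's expected utility `V(μ, σ)`. -/
noncomputable def Val {Ω A : Type*} [Fintype Ω] [Fintype A]
    (v : Ω → A → ℝ) (μ : Ω → ℝ) (σ : Ω → A → ℝ) : ℝ :=
  ∑ ω, ∑ a, μ ω * σ ω a * v ω a

/-- The ℓ1 distance between two functions on a finite set. -/
noncomputable def dist1 {Ω : Type*} [Fintype Ω] (μ ν : Ω → ℝ) : ℝ :=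
  ∑ ω, |μ ω - ν ω|

/-- The closed ℓ1-ball of radius `ε` around `μ`, inside the simplex `Δ(Ω)`. -/
def ball1 {Ω : Type*} [Fintype Ω] (μ : Ω → ℝ) (ε : ℝ) : Set (Ω → ℝ) :=
  {ν | IsDist ν ∧ dist1 ν μ ≤ ε}

/-- The sender's optimal value `OPT(μ)` over mechanisms persuasive for `μ`. -/
noncomputable def OPT {Ω A : Type*} [Fintype Ω] [Fintype A]
    (u v : Ω → A → ℝ) (μ : Ω → ℝ) : ℝ :=
  sSup (Val v μ '' {σ | IsMech σ ∧ Pers u μ σ})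

/-- The sender's optimal value at `μ` over mechanisms persuasive for all priors in `B`. -/
noncomputable def OPTRobust {Ω A : Type*} [Fintype Ω] [Fintype A]
    (u v : Ω → A → ℝ) (μ : Ω → ℝ) (B : Set (Ω → ℝ)) : ℝ :=
  sSup (Val v μ '' {σ | IsMech σ ∧ PersOn u B σ})

/-- The cost of robust persuasion `GAP(μ, B)`. -/
noncomputable def GAP {Ω A : Type*} [Fintype Ω] [Fintype A]
    (u v : Ω → A → ℝ) (μ : Ω → ℝ) (B : Set (Ω → ℝ)) : ℝ :=
  OPT u v μ - OPTRobust u v μ B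

/-- `P_a`: the set of beliefs for which action `a` is optimal for the receiver. -/
def Popt {Ω A : Type*} [Fintype Ω] [Fintype A] (u : Ω → A → ℝ) (a : A) : Set (Ω → ℝ) :=
  {μ | IsDist μ ∧ ∀ a' : A, ∑ ω, μ ω * u ω a' ≤ ∑ ω, μ ω * u ω a}

/-- A point of the cone over the ball around `η`, i.e. a large multiple of `η` plus a small
nonnegative perturbation `q`, still makes `a` optimal. -/
lemma cone_obedient {Ω A : Type*} [Fintype Ω] [Fintype A] {u : Ω → A → ℝ} {a : A} {η : Ω → ℝ}
    {D : ℝ} (hη : IsDist η) (hball : ball1 η D ⊆ Popt u a) {q : Ω → ℝ}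
    (hq : ∀ ω, 0 ≤ q ω) {s : ℝ} (hs : 0 ≤ s) (hqs : 2 * ∑ ω, q ω ≤ D * (s + ∑ ω, q ω)) (a' : A) :
    0 ≤ ∑ ω, (q ω + s * η ω) * (u ω a - u ω a') := by
  have hQ : 0 ≤ ∑ ω, q ω := Finset.sum_nonneg fun ω _ => hq ω
  set Q := ∑ ω, q ω with hQdef
  rcases (add_nonneg hs hQ).eq_or_lt with h0 | hN
  · have hs0 : s = 0 := by linarith
    have hQ0 : Q = 0 := by linarith
    have hq0 : ∀ ω, q ω = 0 := fun ω =>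
      (Finset.sum_eq_zero_iff_of_nonneg fun ω _ => hq ω).1 hQ0 ω (Finset.mem_univ ω)
    simp [hq0, hs0]
  · set N := s + Q with hNdef
    have hmem : (fun ω => (q ω + s * η ω) / N) ∈ ball1 η D := by
      refine ⟨⟨fun ω => div_nonneg (add_nonneg (hq ω) (mul_nonneg hs (hη.1 ω))) hN.le, ?_⟩, ?_⟩
      · rw [← Finset.sum_div, Finset.sum_add_distrib, ← Finset.mul_sum, hη.2, ← hQdef,
          div_eq_one_iff_eq hN.ne']
        ring
      · have hpt : ∀ ω, |(q ω + s * η ω) / N - η ω| ≤ (q ω + Q * η ω) / N := fun ω => by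
          have heq : (q ω + s * η ω) / N - η ω = (q ω - Q * η ω) / N := by
            field_simp
            rw [hNdef]
            ring
          rw [heq, abs_div, abs_of_pos hN]
          refine div_le_div_of_nonneg_right ?_ hN.le
          have h1 := hq ω
          have h2 := mul_nonneg hQ (hη.1 ω)
          rw [abs_le]
          constructor <;> linarith
        refine (Finset.sum_le_sum fun ω _ => hpt ω).trans ?_
        rw [← Finset.sum_div, Finset.sum_add_distrib, ← Finset.mul_sum, hη.2, ← hQdef,
          div_le_iff₀ hN]
        linarith
    have hopt := (hball hmem).2 a'
    have heq : ∑ ω, (q ω + s * η ω) * (u ω a - u ω a') =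
        N * (∑ ω, (q ω + s * η ω) / N * u ω a - ∑ ω, (q ω + s * η ω) / N * u ω a') := by
      rw [← Finset.sum_sub_distrib, Finset.mul_sum]
      refine Finset.sum_congr rfl fun ω _ => ?_
      field_simp
    rw [heq]
    exact mul_nonneg hN.le (by linarith)

/-- The conditional expected utility of the sender in a given state lies in `[0, 1]`. -/
lemma IsMech.sum_mul_mem_Icc {Ω A : Type*} [Fintype A] {v σ : Ω → A → ℝ}
    (hv : ∀ ω a, v ω a ∈ Set.Icc (0 : ℝ) 1) (hσ : IsMech σ) (ω : Ω) :
    ∑ a, σ ω a * v ω a ∈ Set.Icc (0 : ℝ) 1 := by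
  refine ⟨Finset.sum_nonneg fun a _ => mul_nonneg ((hσ ω).1 a) (hv ω a).1, ?_⟩
  rw [← (hσ ω).2]
  exact Finset.sum_le_sum fun a _ => mul_le_of_le_one_right ((hσ ω).1 a) (hv ω a).2

lemma Val_eq_sum_mul {Ω A : Type*} [Fintype Ω] [Fintype A] (v : Ω → A → ℝ) (μ : Ω → ℝ)
    (σ : Ω → A → ℝ) : Val v μ σ = ∑ ω, μ ω * ∑ a, σ ω a * v ω a := by
  simp only [Val, Finset.mul_sum, mul_assoc]

lemma Val_mem_Icc {Ω A : Type*} [Fintype Ω] [Fintype A] {v σ : Ω → A → ℝ} {μ : Ω → ℝ}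
    (hv : ∀ ω a, v ω a ∈ Set.Icc (0 : ℝ) 1) (hμ : IsDist μ) (hσ : IsMech σ) :
    Val v μ σ ∈ Set.Icc (0 : ℝ) 1 := by
  rw [Val_eq_sum_mul]
  refine ⟨Finset.sum_nonneg fun ω _ => mul_nonneg (hμ.1 ω) (hσ.sum_mul_mem_Icc hv ω).1, ?_⟩
  rw [← hμ.2]
  exact Finset.sum_le_sum fun ω _ =>
    mul_le_of_le_one_right (hμ.1 ω) (hσ.sum_mul_mem_Icc hv ω).2

/-- Changing the prior changes the difference in value of two mechanisms by at most the
ℓ1 distance of the priors. -/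
lemma Val_sub_Val_le {Ω A : Type*} [Fintype Ω] [Fintype A] {v σ σ' : Ω → A → ℝ} {μ ν : Ω → ℝ}
    (hv : ∀ ω a, v ω a ∈ Set.Icc (0 : ℝ) 1) (hσ : IsMech σ) (hσ' : IsMech σ') :
    Val v μ σ - Val v μ σ' ≤ Val v ν σ - Val v ν σ' + dist1 μ ν := by
  simp only [Val_eq_sum_mul, dist1, ← Finset.sum_sub_distrib, ← Finset.sum_add_distrib]
  refine Finset.sum_le_sum fun ω _ => ?_
  obtain ⟨h1, h2⟩ := hσ.sum_mul_mem_Icc hv ω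
  obtain ⟨h3, h4⟩ := hσ'.sum_mul_mem_Icc hv ω
  set x := ∑ a, σ ω a * v ω a
  set y := ∑ a, σ' ω a * v ω a
  have h : (μ ω - ν ω) * (x - y) ≤ |μ ω - ν ω| := by
    refine (le_abs_self _).trans ?_
    rw [abs_mul]
    exact mul_le_of_le_one_right (abs_nonneg _) (abs_le.2 ⟨by linarith, by linarith⟩)
  linarith

lemma abs_sub_le_dist1_add {Ω : Type*} [Fintype Ω] (μ ν γ : Ω → ℝ) (ω : Ω) :
    |μ ω - ν ω| ≤ dist1 μ γ + dist1 ν γ := by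
  have h1 : |μ ω - γ ω| ≤ dist1 μ γ :=
    Finset.single_le_sum (f := fun ω => |μ ω - γ ω|) (fun _ _ => abs_nonneg _) (Finset.mem_univ ω)
  have h2 : |ν ω - γ ω| ≤ dist1 ν γ :=
    Finset.single_le_sum (f := fun ω => |ν ω - γ ω|) (fun _ _ => abs_nonneg _) (Finset.mem_univ ω)
  have h3 := abs_sub_le (μ ω) (γ ω) (ν ω)
  rw [abs_sub_comm (γ ω)] at h3
  linarith

/-- A mechanism completed by revealing the state with the leftover probability. -/
lemma exists_completion {Ω A : Type*} [Fintype Ω] [Fintype A] [Nonempty A] (u : Ω → A → ℝ)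
    {θ : Ω → A → ℝ} (hθ : ∀ ω a, 0 ≤ θ ω a) (hθ1 : ∀ ω, ∑ a, θ ω a ≤ 1) :
    ∃ σ : Ω → A → ℝ, IsMech σ ∧ (∀ ω a, θ ω a ≤ σ ω a) ∧
      ∀ μ : Ω → ℝ, (∀ ω, 0 ≤ μ ω) → Pers u μ θ → Pers u μ σ := by
  classical
  choose b hb using fun ω => Finite.exists_max (u ω)
  have hrest : ∀ ω a, 0 ≤ if a = b ω then 1 - ∑ a, θ ω a else 0 := fun ω a => by
    split_ifs
    · linarith [hθ1 ω]
    · exact le_rfl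
  refine ⟨fun ω a => θ ω a + if a = b ω then 1 - ∑ a, θ ω a else 0, fun ω => ⟨fun a =>
    add_nonneg (hθ ω a) (hrest ω a), ?_⟩, fun ω a => le_add_of_nonneg_right (hrest ω a), ?_⟩
  · rw [Finset.sum_add_distrib, Finset.sum_ite_eq' Finset.univ (b ω)]
    simp
  · intro μ hμ hP a a'
    refine (hP a a').trans (Finset.sum_le_sum fun ω _ => ?_)
    have h : 0 ≤ μ ω * ((if a = b ω then 1 - ∑ a, θ ω a else 0) * (u ω a - u ω a')) := by
      refine mul_nonneg (hμ ω) ?_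
      by_cases hab : a = b ω
      · refine mul_nonneg (hrest ω a) ?_
        rw [hab]
        linarith [hb ω a']
      · simp [hab]
    linarith

/-- A mechanism persuasive at `μ` can be made persuasive for all priors whose densities relative
to `μ` lie within `c` of `1`, at a cost of at most `κ / p0`. -/
lemma exists_robust_mech {Ω A : Type*} [Fintype Ω] [Fintype A] [Nonempty A] {u v : Ω → A → ℝ}
    (hv : ∀ ω a, v ω a ∈ Set.Icc (0 : ℝ) 1) {D : ℝ} (hD : 0 < D)
    (hreg : ∀ a : A, ∃ η : Ω → ℝ, η ∈ Popt u a ∧ ball1 η D ⊆ Popt u a)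
    {p0 : ℝ} (hp0 : 0 < p0) {μ : Ω → ℝ} (hμ : IsDist μ) (hμp : ∀ ω, p0 ≤ μ ω)
    {c κ : ℝ} (hc1 : c ≤ 1) (hκ : 0 ≤ κ)
    (hcκ : 4 * c * (1 + κ) ≤ D * ((1 - c) * κ))
    {τ : Ω → A → ℝ} (hτ : IsMech τ) (hτP : Pers u μ τ) :
    ∃ σ : Ω → A → ℝ, IsMech σ ∧ Val v μ τ - κ / p0 ≤ Val v μ σ ∧
      ∀ ν : Ω → ℝ, (∀ ω, |ν ω - μ ω| ≤ c * μ ω) → Pers u ν σ := by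
  choose η hη hηball using hreg
  have hμ0 : ∀ ω, 0 < μ ω := fun ω => hp0.trans_le (hμp ω)
  have hη0 : ∀ a ω, 0 ≤ η a ω := fun a ω => (hη a).1.1 ω
  set T : A → ℝ := fun a => ∑ ω, μ ω * τ ω a with hTdef
  have hT0 : ∀ a, 0 ≤ T a := fun a =>
    Finset.sum_nonneg fun ω _ => mul_nonneg (hμ0 ω).le ((hτ ω).1 a)
  have hT1 : ∑ a, T a = 1 := by
    simp only [hTdef]
    rw [Finset.sum_comm]
    simp only [← Finset.mul_sum, (hτ _).2, mul_one, hμ.2]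
  have hκp : 0 ≤ κ / p0 := div_nonneg hκ hp0.le
  set k : ℝ := 1 / (1 + κ / p0) with hkdef
  have hk0 : 0 ≤ k := by positivity
  have hk : k * (1 + κ / p0) = 1 := one_div_mul_cancel (by positivity)
  have hextra : ∀ ω a, 0 ≤ κ * T a * η a ω / μ ω := fun ω a =>
    div_nonneg (mul_nonneg (mul_nonneg hκ (hT0 a)) (hη0 a ω)) (hμ0 ω).le
  set θ : Ω → A → ℝ := fun ω a => k * (τ ω a + κ * T a * η a ω / μ ω) with hθdef
  have hθ0 : ∀ ω a, 0 ≤ θ ω a := fun ω a =>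
    mul_nonneg hk0 (add_nonneg ((hτ ω).1 a) (hextra ω a))
  have hθ1 : ∀ ω, ∑ a, θ ω a ≤ 1 := fun ω => by
    simp only [hθdef]
    rw [← Finset.mul_sum, Finset.sum_add_distrib, (hτ ω).2]
    refine (mul_le_mul_of_nonneg_left (add_le_add_right ?_ _) hk0).trans hk.le
    have hpt : ∀ a, κ * T a * η a ω / μ ω ≤ κ / p0 * T a := fun a => by
      have h1 : η a ω ≤ 1 := by
        rw [← (hη a).1.2]
        exact Finset.single_le_sum (fun ω _ => hη0 a ω) (Finset.mem_univ ω)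
      calc κ * T a * η a ω / μ ω ≤ κ * T a * 1 / p0 :=
            div_le_div₀ (by have := hT0 a; positivity)
              (mul_le_mul_of_nonneg_left h1 (mul_nonneg hκ (hT0 a))) hp0 (hμp ω)
        _ = κ / p0 * T a := by ring
    refine (Finset.sum_le_sum fun a _ => hpt a).trans ?_
    rw [← Finset.mul_sum, hT1, mul_one]
  obtain ⟨σ, hσ, hθσ, hσP⟩ := exists_completion u hθ0 hθ1
  refine ⟨σ, hσ, ?_, fun ν hν => hσP ν (fun ω => ?_) fun a a' => ?_⟩
  · have hle : k * Val v μ τ ≤ Val v μ σ := by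
      simp only [Val, Finset.mul_sum]
      refine Finset.sum_le_sum fun ω _ => Finset.sum_le_sum fun a _ => ?_
      have h1 : k * τ ω a ≤ σ ω a :=
        (mul_le_mul_of_nonneg_left (le_add_of_nonneg_right (hextra ω a)) hk0).trans (hθσ ω a)
      calc k * (μ ω * τ ω a * v ω a) = μ ω * (k * τ ω a) * v ω a := by ring
        _ ≤ μ ω * σ ω a * v ω a := mul_le_mul_of_nonneg_right
            (mul_le_mul_of_nonneg_left h1 (hμ0 ω).le) (hv ω a).1
    obtain ⟨h0, h1⟩ := Val_mem_Icc hv hμ hτ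
    have hk1 : k ≤ 1 := by nlinarith
    have h2 : 1 - k ≤ κ / p0 := by nlinarith
    nlinarith
  · have := (abs_le.1 (hν ω)).1
    nlinarith [hμ0 ω]
  · set r : Ω → ℝ := fun ω => ν ω / μ ω with hrdef
    have hr : ∀ ω, 0 ≤ r ω - (1 - c) ∧ r ω - (1 - c) ≤ 2 * c := fun ω => by
      obtain ⟨h1, h2⟩ := abs_le.1 (hν ω)
      have h3 : 1 - c ≤ r ω := by rw [hrdef, le_div_iff₀ (hμ0 ω)]; linarith
      have h4 : r ω ≤ 1 + c := by rw [hrdef, div_le_iff₀ (hμ0 ω)]; linarith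
      constructor <;> linarith
    set x : Ω → ℝ := fun ω => μ ω * τ ω a + κ * T a * η a ω with hxdef
    have hx0 : ∀ ω, 0 ≤ x ω := fun ω => add_nonneg (mul_nonneg (hμ0 ω).le ((hτ ω).1 a))
      (mul_nonneg (mul_nonneg hκ (hT0 a)) (hη0 a ω))
    have hxsum : ∑ ω, x ω = (1 + κ) * T a := by
      simp only [hxdef]
      rw [Finset.sum_add_distrib, ← Finset.mul_sum, (hη a).1.2]
      simp only [hTdef]
      ring
    set q : Ω → ℝ := fun ω => (r ω - (1 - c)) * x ω with hqdef
    have hq0 : ∀ ω, 0 ≤ q ω := fun ω => mul_nonneg (hr ω).1 (hx0 ω)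
    have hqsum : ∑ ω, q ω ≤ 2 * c * ((1 + κ) * T a) := by
      rw [← hxsum, Finset.mul_sum]
      exact Finset.sum_le_sum fun ω _ => mul_le_mul_of_nonneg_right (hr ω).2 (hx0 ω)
    have hs0 : 0 ≤ (1 - c) * (κ * T a) := mul_nonneg (by linarith) (mul_nonneg hκ (hT0 a))
    have hcone := cone_obedient (hη a).1 (hηball a) hq0 hs0 (by
      have h1 := mul_le_mul_of_nonneg_right hcκ (hT0 a)
      have h2 := mul_nonneg hD.le (Finset.sum_nonneg fun ω (_ : ω ∈ Finset.univ) => hq0 ω)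
      linarith) a'
    have heq : ∑ ω, ν ω * θ ω a * (u ω a - u ω a') =
        k * ((1 - c) * (∑ ω, μ ω * τ ω a * (u ω a - u ω a')) +
          ∑ ω, (q ω + (1 - c) * (κ * T a) * η a ω) * (u ω a - u ω a')) := by
      rw [Finset.mul_sum, ← Finset.sum_add_distrib, Finset.mul_sum]
      refine Finset.sum_congr rfl fun ω _ => ?_
      have hμω := (hμ0 ω).ne'
      simp only [hθdef, hqdef, hxdef, hrdef]
      field_simp
      ring
    rw [heq]
    exact mul_nonneg hk0 (add_nonneg (mul_nonneg (by linarith) (hτP a a')) hcone)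

/-- If the regularity constant is at least the diameter of the simplex, every mechanism is
persuasive for every prior. -/
lemma pers_of_two_le {Ω A : Type*} [Fintype Ω] [Fintype A] {u : Ω → A → ℝ} {D : ℝ} (hD : 2 ≤ D)
    (hreg : ∀ a : A, ∃ η : Ω → ℝ, η ∈ Popt u a ∧ ball1 η D ⊆ Popt u a)
    {ν : Ω → ℝ} (hν : ∀ ω, 0 ≤ ν ω) {τ : Ω → A → ℝ} (hτ : IsMech τ) : Pers u ν τ := by
  intro a a'
  obtain ⟨η, hη, hball⟩ := hreg a
  have hq : ∀ ω, 0 ≤ ν ω * τ ω a := fun ω => mul_nonneg (hν ω) ((hτ ω).1 a)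
  have h := cone_obedient hη.1 hball hq le_rfl (by
    rw [zero_add]
    exact mul_le_mul_of_nonneg_right hD (Finset.sum_nonneg fun ω _ => hq ω)) a'
  simpa using h

/-- Per-round loss of the RAI rule (deterministic core of the regret bound):
under regularity with constant `D`, if `min_ω μ*(ω) ≥ p0`, `‖μ* − γ‖₁ ≤ ε`, and `σ`
maximizes `V(γ, ·)` over mechanisms persuasive on `B₁(γ, ε)`, then `σ` is persuasive
for `μ*` and `OPT(μ*) − V(μ*, σ) ≤ (20/(p0² D) + 1)·ε`. -/
theorem stmt12 {Ω A : Type*} [Fintype Ω] [Fintype A]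
    (hΩ : 2 ≤ Fintype.card Ω) (hA : 2 ≤ Fintype.card A)
    (u : Ω → A → ℝ) (v : Ω → A → ℝ) (hv : ∀ ω a, v ω a ∈ Set.Icc (0 : ℝ) 1)
    (D : ℝ) (hD : 0 < D)
    (hreg : ∀ a : A, ∃ η : Ω → ℝ, η ∈ Popt u a ∧ ball1 η D ⊆ Popt u a)
    (p0 : ℝ) (hp0 : 0 < p0)
    (μstar : Ω → ℝ) (hμ : IsDist μstar) (hμp : ∀ ω, p0 ≤ μstar ω)
    (ε : ℝ) (hε : 0 ≤ ε)
    (γ : Ω → ℝ) (hγ : IsDist γ) (hγμ : dist1 μstar γ ≤ ε)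
    (σ : Ω → A → ℝ) (hσM : IsMech σ) (hσP : PersOn u (ball1 γ ε) σ)
    (hσmax : ∀ σ' : Ω → A → ℝ, IsMech σ' → PersOn u (ball1 γ ε) σ' →
      Val v γ σ' ≤ Val v γ σ) :
    Pers u μstar σ ∧ OPT u v μstar - Val v μstar σ ≤ (20 / (p0 ^ 2 * D) + 1) * ε := by
  have hmem : μstar ∈ ball1 γ ε := ⟨hμ, hγμ⟩
  have hP : Pers u μstar σ := hσP μstar hmem
  refine ⟨hP, ?_⟩
  have hA0 : Nonempty A := Fintype.card_pos_iff.1 (by omega)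
  obtain ⟨ω₀⟩ : Nonempty Ω := Fintype.card_pos_iff.1 (by omega)
  have hp1 : p0 ≤ 1 := by
    rw [← hμ.2]
    exact (hμp ω₀).trans (Finset.single_le_sum (fun ω _ => hμ.1 ω) (Finset.mem_univ ω₀))
  suffices h : ∀ τ, IsMech τ → Pers u μstar τ →
      Val v μstar τ ≤ (20 / (p0 ^ 2 * D) + 1) * ε + Val v μstar σ by
    rw [sub_le_iff_le_add]
    refine csSup_le ⟨_, σ, ⟨hσM, hP⟩, rfl⟩ ?_
    rintro _ ⟨τ, ⟨hτ, hτP⟩, rfl⟩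
    exact h τ hτ hτP
  intro τ hτ hτP
  have hE0 : 0 ≤ 20 / (p0 ^ 2 * D) * ε := by positivity
  suffices h : 1 ≤ 20 / (p0 ^ 2 * D) * ε ∨ ∃ σ', IsMech σ' ∧ PersOn u (ball1 γ ε) σ' ∧
      Val v μstar τ - 20 / (p0 ^ 2 * D) * ε ≤ Val v μstar σ' by
    rcases h with h | ⟨σ', hσ', hσ'P, hle⟩
    · linarith [(Val_mem_Icc hv hμ hτ).2, (Val_mem_Icc hv hμ hσM).1]
    · linarith [Val_sub_Val_le (μ := μstar) (ν := γ) hv hσ' hσM, hσmax σ' hσ' hσ'P]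
  rcases le_or_gt 1 (20 / (p0 ^ 2 * D) * ε) with hbig | hsmall
  · exact Or.inl hbig
  right
  rcases le_or_gt 2 D with hD2 | hD2
  · exact ⟨τ, hτ, fun ν hν => pers_of_two_le hD2 hreg hν.1.1 hτ, by linarith⟩
  have hεsmall : 20 * ε < p0 ^ 2 * D := by
    rwa [div_mul_eq_mul_div, div_lt_one (by positivity)] at hsmall
  set c : ℝ := 2 * ε / p0 with hcdef
  set κ : ℝ := 20 * ε / (p0 * D) with hκdef
  have hc0 : 0 ≤ c := by positivity
  have hκ0 : 0 ≤ κ := by positivity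
  have hcp : c * p0 = 2 * ε := div_mul_cancel₀ _ hp0.ne'
  have hκD : D * κ = 10 * c := by
    rw [hκdef, hcdef]
    field_simp
    ring
  have hκ1 : κ ≤ 1 := by
    rw [hκdef, div_le_one (by positivity)]
    nlinarith [mul_pos hp0 hD]
  have hc5 : c ≤ 1 / 5 := by
    rw [hcdef, div_le_iff₀ hp0]
    nlinarith [mul_pos hp0 hD]
  have hcκ : 4 * c * (1 + κ) ≤ D * ((1 - c) * κ) := by
    rw [mul_left_comm, hκD]
    nlinarith [mul_nonneg hc0 (sub_nonneg.2 hκ1), mul_nonneg hc0 (sub_nonneg.2 hc5)]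
  obtain ⟨σ', hσ', hle, hσ'P⟩ :=
    exists_robust_mech hv hD hreg hp0 hμ hμp (by linarith) hκ0 hcκ hτ hτP
  refine ⟨σ', hσ', fun ν hν => hσ'P ν fun ω => ?_, ?_⟩
  · have h1 := abs_sub_le_dist1_add ν μstar γ ω
    have h2 := hν.2
    have h3 := mul_le_mul_of_nonneg_left (hμp ω) hc0
    linarith
  · have hκp : κ / p0 = 20 / (p0 ^ 2 * D) * ε := by
      rw [hκdef]
      field_simp
    rwa [← hκp]
end

section
/- Posterior stability under prior perturbation: let Ω be a finite set and let μ, γ, ξ ∈ Δ(Ω) with μ(ω) > 0 for every ω and Z := Σ_ω γ(ω)·ξ(ω)/μ(ω) > 0. Define γ'(ω) := (γ(ω)·ξ(ω)/μ(ω)) / Z. Then ‖γ' − ξ‖₁ ≤ 2·(max_ω ξ(ω)/μ(ω))·‖γ − μ‖₁. In particular, if min_ω μ(ω) ≥ p0 > 0 then ‖γ' − ξ‖₁ ≤ (2/p0)·‖γ − μ‖₁. -/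
/-- Normalizing a nonnegative function moves it away from a given distribution by at most
a factor of two in ℓ1 distance. -/
lemma dist1_div_sum_le {Ω : Type*} [Fintype Ω] (a b : Ω → ℝ) (ha : ∀ ω, 0 ≤ a ω)
    (hb : ∑ ω, b ω = 1) (hpos : 0 < ∑ ω, a ω) :
    dist1 (fun ω => a ω / ∑ i, a i) b ≤ 2 * dist1 a b := by
  set Z := ∑ i, a i with hZ
  have hnorm : ∑ ω, |a ω / Z - a ω| = |1 - Z| := by
    have hterm : ∀ ω, |a ω / Z - a ω| = a ω * (|1 - Z| / Z) := fun ω => by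
      rw [show a ω / Z - a ω = a ω * ((1 - Z) / Z) by field_simp, abs_mul, abs_div,
        abs_of_nonneg (ha ω), abs_of_pos hpos]
    simp_rw [hterm]
    rw [← Finset.sum_mul, ← hZ]
    field_simp
  have hmass : |1 - Z| ≤ dist1 a b := by
    rw [abs_sub_comm, ← hb, hZ, ← Finset.sum_sub_distrib]
    exact Finset.abs_sum_le_sum_abs _ _
  calc dist1 (fun ω => a ω / Z) b
      ≤ ∑ ω, (|a ω / Z - a ω| + |a ω - b ω|) :=
        Finset.sum_le_sum fun ω _ => abs_sub_le _ _ _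
    _ = |1 - Z| + dist1 a b := by rw [Finset.sum_add_distrib, hnorm, dist1]
    _ ≤ 2 * dist1 a b := by linarith

/-- Reweighting by a likelihood ratio bounded by `M` expands the ℓ1 distance by at most `M`. -/
lemma dist1_reweight_le {Ω : Type*} [Fintype Ω] (μ γ ξ : Ω → ℝ) (hξ : ∀ ω, 0 ≤ ξ ω)
    (hμ : ∀ ω, 0 < μ ω) {M : ℝ} (hM : ∀ ω, ξ ω / μ ω ≤ M) :
    dist1 (fun ω => γ ω * ξ ω / μ ω) ξ ≤ M * dist1 γ μ := by
  rw [dist1, dist1, Finset.mul_sum]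
  refine Finset.sum_le_sum fun ω _ => ?_
  have hω := (hμ ω).ne'
  rw [show γ ω * ξ ω / μ ω - ξ ω = ξ ω / μ ω * (γ ω - μ ω) by field_simp, abs_mul,
    abs_of_nonneg (div_nonneg (hξ ω) (hμ ω).le)]
  exact mul_le_mul_of_nonneg_right (hM ω) (abs_nonneg _)

/-- Posterior stability under prior perturbation: if `γ'` is the posterior of a receiver
with prior `γ` for a signal with likelihood proportional to `ξ(ω)/μ(ω)` (whose posterior
under the prior `μ` is `ξ`), then `‖γ' − ξ‖₁ ≤ 2·(max_ω ξ(ω)/μ(ω))·‖γ − μ‖₁`; in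
particular `‖γ' − ξ‖₁ ≤ (2/p0)·‖γ − μ‖₁` whenever `min_ω μ(ω) ≥ p0 > 0`. -/
theorem stmt15 {Ω : Type*} [Fintype Ω] [Nonempty Ω]
    (μ γ ξ : Ω → ℝ) (hμ : IsDist μ) (hγ : IsDist γ) (hξ : IsDist ξ)
    (hμpos : ∀ ω, 0 < μ ω)
    (Z : ℝ) (hZ : Z = ∑ ω, γ ω * ξ ω / μ ω) (hZpos : 0 < Z) :
    dist1 (fun ω => (γ ω * ξ ω / μ ω) / Z) ξ ≤ 2 * (⨆ ω, ξ ω / μ ω) * dist1 γ μ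
    ∧ ∀ p0 : ℝ, 0 < p0 → (∀ ω, p0 ≤ μ ω) →
        dist1 (fun ω => (γ ω * ξ ω / μ ω) / Z) ξ ≤ (2 / p0) * dist1 γ μ := by
  have key : ∀ M : ℝ, (∀ ω, ξ ω / μ ω ≤ M) →
      dist1 (fun ω => (γ ω * ξ ω / μ ω) / Z) ξ ≤ 2 * M * dist1 γ μ := fun M hM => by
    subst hZ
    have h := dist1_div_sum_le (fun ω => γ ω * ξ ω / μ ω) ξ
      (fun ω => div_nonneg (mul_nonneg (hγ.1 ω) (hξ.1 ω)) (hμ.1 ω)) hξ.2 hZpos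
    have h' := dist1_reweight_le μ γ ξ hξ.1 hμpos hM
    linarith
  refine ⟨key _ fun ω => le_ciSup (f := fun ω => ξ ω / μ ω) (Set.finite_range _).bddAbove ω,
    fun p0 hp0 hp => ?_⟩
  have hle : ∀ ω, ξ ω ≤ 1 := fun ω =>
    hξ.2 ▸ Finset.single_le_sum (fun i _ => hξ.1 i) (Finset.mem_univ ω)
  have h := key (1 / p0) fun ω => div_le_div₀ zero_le_one (hle ω) hp0 (hp ω)
  rwa [mul_one_div] at h
end

section
/- Expected ℓ1 deviation of the empirical distribution: let Ω be a finite set, μ ∈ Δ(Ω), t ≥ 1, and let γ_t be the empirical distribution of t i.i.d. samples from μ. Then E[‖γ_t − μ‖₁] ≤ (1/√t)·Σ_ω √(μ(ω)(1 − μ(ω))) ≤ √(|Ω|/t). -/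
/-- The probability of the event `E` when `T` states are drawn i.i.d. from `μ`. -/
noncomputable def prodProb {Ω : Type*} [Fintype Ω] {T : ℕ}
    (μ : Ω → ℝ) (E : Set (Fin T → Ω)) : ℝ :=
  ∑ x : Fin T → Ω, Set.indicator E (fun y => ∏ t, μ (y t)) x

/-- The expectation of `f` when `T` states are drawn i.i.d. from `μ`. -/
noncomputable def prodExp {Ω : Type*} [Fintype Ω] {T : ℕ}
    (μ : Ω → ℝ) (f : (Fin T → Ω) → ℝ) : ℝ :=
  ∑ x : Fin T → Ω, (∏ t, μ (x t)) * f x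

/-- The empirical distribution of the first `t` of the samples `x`. -/
noncomputable def emp {Ω : Type*} [Fintype Ω] [DecidableEq Ω] {T : ℕ}
    (x : Fin T → Ω) (t : ℕ) : Ω → ℝ :=
  fun ω => ((Finset.univ.filter fun τ : Fin T => τ.1 < t ∧ x τ = ω).card : ℝ) / t

theorem prodExp_succ {Ω : Type*} [Fintype Ω] {n : ℕ} (μ : Ω → ℝ) (g : (Fin (n + 1) → Ω) → ℝ) :
    prodExp μ g = ∑ a, μ a * prodExp μ (fun x : Fin n → Ω => g (Fin.cons a x)) := by
  unfold prodExp
  rw [← (Fin.consEquiv fun _ : Fin (n + 1) => Ω).sum_comp, Fintype.sum_prod_type]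
  simp [Fin.consEquiv, Fin.prod_univ_succ, Finset.mul_sum, mul_assoc]

theorem prodExp_add {Ω : Type*} [Fintype Ω] {n : ℕ} (μ : Ω → ℝ) (f g : (Fin n → Ω) → ℝ) :
    prodExp μ (fun x => f x + g x) = prodExp μ f + prodExp μ g := by
  simp [prodExp, mul_add, Finset.sum_add_distrib]

theorem prodExp_const_mul {Ω : Type*} [Fintype Ω] {n : ℕ} (μ : Ω → ℝ) (c : ℝ)
    (f : (Fin n → Ω) → ℝ) : prodExp μ (fun x => c * f x) = c * prodExp μ f := by
  simp [prodExp, Finset.mul_sum, mul_left_comm]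

theorem prodExp_finset_sum {Ω ι : Type*} [Fintype Ω] {n : ℕ} (μ : Ω → ℝ) (s : Finset ι)
    (f : ι → (Fin n → Ω) → ℝ) :
    prodExp μ (fun x => ∑ i ∈ s, f i x) = ∑ i ∈ s, prodExp μ (f i) := by
  simp only [prodExp, Finset.mul_sum]
  exact Finset.sum_comm

theorem prodExp_const {Ω : Type*} [Fintype Ω] {μ : Ω → ℝ} (hμ : ∑ ω, μ ω = 1) (n : ℕ) (c : ℝ) :
    prodExp μ (fun _ : Fin n → Ω => c) = c := by
  induction n with
  | zero => simp [prodExp]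
  | succ n ih => rw [prodExp_succ]; simp only [ih]; rw [← Finset.sum_mul, hμ, one_mul]

/-- A sum of i.i.d. centered variables is centered. -/
theorem prodExp_sum_eq_zero {Ω : Type*} [Fintype Ω] {μ f : Ω → ℝ} (hμ : ∑ ω, μ ω = 1)
    (hf : ∑ ω, μ ω * f ω = 0) (n : ℕ) :
    prodExp μ (fun x : Fin n → Ω => ∑ i, f (x i)) = 0 := by
  induction n with
  | zero => simp [prodExp]
  | succ n ih =>
    rw [prodExp_succ]
    simp only [Fin.sum_univ_succ, Fin.cons_zero, Fin.cons_succ, prodExp_add, prodExp_const hμ, ih,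
      add_zero, hf]

/-- The variance of a sum of i.i.d. centered variables is additive. -/
theorem prodExp_sum_sq {Ω : Type*} [Fintype Ω] {μ f : Ω → ℝ} (hμ : ∑ ω, μ ω = 1)
    (hf : ∑ ω, μ ω * f ω = 0) (n : ℕ) :
    prodExp μ (fun x : Fin n → Ω => (∑ i, f (x i)) ^ 2) = n * ∑ ω, μ ω * f ω ^ 2 := by
  induction n with
  | zero => simp [prodExp]
  | succ n ih =>
    rw [prodExp_succ]
    simp only [Fin.sum_univ_succ, Fin.cons_zero, Fin.cons_succ, add_sq, prodExp_add,
      prodExp_const hμ, prodExp_const_mul, prodExp_sum_eq_zero hμ hf, ih, mul_zero, add_zero,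
      mul_add, Finset.sum_add_distrib]
    rw [← Finset.sum_mul, hμ]
    push_cast
    ring

/-- Jensen's inequality `E|f| ≤ √(E[f²])`. -/
theorem prodExp_abs_le_sqrt {Ω : Type*} [Fintype Ω] {μ : Ω → ℝ} (hμ : IsDist μ) {n : ℕ}
    (f : (Fin n → Ω) → ℝ) :
    prodExp μ (fun x => |f x|) ≤ Real.sqrt (prodExp μ fun x => f x ^ 2) := by
  apply Real.le_sqrt_of_sq_le
  have hp : ∀ x : Fin n → Ω, 0 ≤ ∏ t, μ (x t) := fun x => Finset.prod_nonneg fun t _ => hμ.1 _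
  have h := Finset.sum_sq_le_sum_mul_sum_of_sq_le_mul Finset.univ
    (r := fun x : Fin n → Ω => (∏ t, μ (x t)) * |f x|) (f := fun x => ∏ t, μ (x t))
    (g := fun x => (∏ t, μ (x t)) * f x ^ 2) (fun x _ => hp x)
    (fun x _ => mul_nonneg (hp x) (sq_nonneg _))
    (fun x _ => by rw [mul_pow, sq_abs]; exact le_of_eq (by ring))
  have h1 := prodExp_const hμ.2 n 1
  simp only [prodExp, mul_one] at h1
  rwa [h1, one_mul] at h

theorem emp_sub_eq {Ω : Type*} [Fintype Ω] [DecidableEq Ω] (μ : Ω → ℝ) {t : ℕ} (ht : 1 ≤ t)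
    (x : Fin t → Ω) (ω : Ω) :
    emp x t ω - μ ω = (t : ℝ)⁻¹ * ∑ i, ((if x i = ω then 1 else 0) - μ ω) := by
  have ht' : (t : ℝ) ≠ 0 := by positivity
  simp only [emp, Fin.is_lt, true_and, Finset.sum_sub_distrib, Finset.sum_boole,
    Finset.sum_const, Finset.card_univ, Fintype.card_fin, nsmul_eq_mul]
  field_simp

theorem prodExp_abs_emp_sub_le {Ω : Type*} [Fintype Ω] [DecidableEq Ω] {μ : Ω → ℝ}
    (hμ : IsDist μ) {t : ℕ} (ht : 1 ≤ t) (ω : Ω) :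
    prodExp μ (fun x : Fin t → Ω => |emp x t ω - μ ω|)
      ≤ (1 / Real.sqrt t) * Real.sqrt (μ ω * (1 - μ ω)) := by
  have ht' : (t : ℝ) ≠ 0 := by positivity
  have hmean : ∑ a, μ a * ((if a = ω then 1 else 0) - μ ω) = 0 := by
    simp [mul_sub, Finset.sum_sub_distrib, ← Finset.sum_mul, hμ.2]
  have hvar : ∑ a, μ a * ((if a = ω then 1 else 0) - μ ω) ^ 2 = μ ω * (1 - μ ω) := by
    have h : ∀ a, μ a * ((if a = ω then 1 else 0) - μ ω) ^ 2
        = (if a = ω then μ a * (1 - 2 * μ ω) else 0) + μ a * μ ω ^ 2 := by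
      intro a
      split_ifs <;> ring
    simp only [h, Finset.sum_add_distrib, ← Finset.sum_mul, hμ.2, Finset.sum_ite_eq',
      Finset.mem_univ, if_true]
    ring
  refine (prodExp_abs_le_sqrt hμ _).trans_eq ?_
  simp only [emp_sub_eq μ ht, mul_pow, prodExp_const_mul]
  rw [prodExp_sum_sq hμ.2 hmean, hvar, one_div, ← Real.sqrt_inv, ← Real.sqrt_mul (by positivity)]
  congr 1
  field_simp

theorem sum_sqrt_le_sqrt_card {Ω : Type*} [Fintype Ω] {μ : Ω → ℝ} (hμ : IsDist μ) :
    ∑ ω, Real.sqrt (μ ω * (1 - μ ω)) ≤ Real.sqrt (Fintype.card Ω) := by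
  apply Real.le_sqrt_of_sq_le
  calc (∑ ω, Real.sqrt (μ ω * (1 - μ ω))) ^ 2
      ≤ (∑ ω, Real.sqrt (μ ω)) ^ 2 := by
        gcongr with ω
        nlinarith [hμ.1 ω]
    _ ≤ Fintype.card Ω * ∑ ω, Real.sqrt (μ ω) ^ 2 := sq_sum_le_card_mul_sum_sq
    _ = Fintype.card Ω := by simp [Real.sq_sqrt (hμ.1 _), hμ.2]

/-- Expected ℓ1 deviation of the empirical distribution:
`E[‖γ_t − μ‖₁] ≤ (1/√t)·Σ_ω √(μ(ω)(1−μ(ω))) ≤ √(|Ω|/t)`. -/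
theorem stmt16 {Ω : Type*} [Fintype Ω] [DecidableEq Ω]
    (μ : Ω → ℝ) (hμ : IsDist μ) (t : ℕ) (ht : 1 ≤ t) :
    prodExp μ (fun x : Fin t → Ω => dist1 (emp x t) μ)
      ≤ (1 / Real.sqrt t) * ∑ ω, Real.sqrt (μ ω * (1 - μ ω))
    ∧ (1 / Real.sqrt t) * ∑ ω, Real.sqrt (μ ω * (1 - μ ω))
      ≤ Real.sqrt ((Fintype.card Ω : ℝ) / t) := by
  constructor
  · simp only [dist1]
    rw [prodExp_finset_sum, Finset.mul_sum]
    exact Finset.sum_le_sum fun ω _ => prodExp_abs_emp_sub_le hμ ht ω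
  · rw [Real.sqrt_div (by positivity), one_div_mul_eq_div]
    gcongr
    exact sum_sqrt_le_sqrt_card hμ
end

section
/- Existence of a near-optimal robustly persuasive mechanism (multiplicative form of Proposition 1): assume the regularity condition with constant D > 0 and let p0 > 0. For any μ ∈ Δ(Ω) with min_ω μ(ω) ≥ p0 and any ε ≥ 0, sup{ V(μ, σ) : σ ∈ Pers(B₁(μ, ε)) } ≥ (1 − 4ε/(p0²·D))·OPT(μ). Equivalently, there exists a signaling mechanism that is simultaneously persuasive for every prior in the ℓ1-ball of radius ε around μ and whose sender value at μ is at least a (1 − 4ε/(p0²·D)) fraction of the optimum. -/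
theorem IsDist.le_one {Ω : Type*} [Fintype Ω] {μ : Ω → ℝ} (h : IsDist μ) (ω : Ω) : μ ω ≤ 1 :=
  h.2 ▸ Finset.single_le_sum (fun i _ => h.1 i) (Finset.mem_univ ω)

/-- Two distributions differ at a single point by at most half their ℓ1 distance. -/
theorem IsDist.abs_sub_le {Ω : Type*} [Fintype Ω] {μ ν : Ω → ℝ} (hμ : IsDist μ)
    (hν : IsDist ν) (ω : Ω) : |ν ω - μ ω| ≤ dist1 ν μ / 2 := by
  classical
  have h0 : ∑ i, (ν i - μ i) = 0 := by rw [Finset.sum_sub_distrib, hν.2, hμ.2, sub_self]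
  rw [← Finset.add_sum_erase _ _ (Finset.mem_univ ω)] at h0
  have h1 := Finset.abs_sum_le_sum_abs (fun i => ν i - μ i) (Finset.univ.erase ω)
  rw [eq_neg_of_add_eq_zero_right h0, abs_neg] at h1
  have h2 := Finset.add_sum_erase Finset.univ (fun i => |ν i - μ i|) (Finset.mem_univ ω)
  simp only [dist1, ← h2]
  linarith

/-- A linear functional that is nonnegative on the ball of radius `D` around `η` in the simplex
is bounded below at `η` in terms of its negative values at the vertices. -/
theorem neg_mul_le_sum_of_nonneg_on_ball1 {Ω : Type*} [Fintype Ω] {η : Ω → ℝ} (hη : IsDist η)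
    {D : ℝ} (hD : 0 < D) {g : Ω → ℝ} (hg : ∀ ν ∈ ball1 η D, 0 ≤ ∑ ω, ν ω * g ω) (ω₀ : Ω) :
    -(D / 2 * g ω₀) ≤ ∑ ω, η ω * g ω ∧ (g ω₀ < 0 → D < 2) := by
  classical
  have hη0 : 0 ≤ ∑ ω, η ω * g ω := hg η ⟨hη, by simp [dist1, hD.le]⟩
  have key : ∀ t : ℝ, 0 ≤ t → t ≤ 1 → 2 * t ≤ D →
      0 ≤ (1 - t) * (∑ ω, η ω * g ω) + t * g ω₀ := by
    intro t ht0 ht1 htD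
    have hsum : ∑ ω, ((1 - t) * η ω + t * if ω = ω₀ then 1 else 0) * g ω
        = (1 - t) * (∑ ω, η ω * g ω) + t * g ω₀ := by
      simp only [add_mul, Finset.sum_add_distrib, Finset.mul_sum, mul_assoc]
      simp
    rw [← hsum]
    refine hg _ ⟨⟨fun ω => ?_, ?_⟩, ?_⟩
    · have := mul_nonneg (sub_nonneg.2 ht1) (hη.1 ω)
      dsimp only
      split_ifs <;> linarith
    · rw [Finset.sum_add_distrib, ← Finset.mul_sum, ← Finset.mul_sum, hη.2]
      simp
    · refine le_trans ?_ htD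
      calc dist1 (fun ω => (1 - t) * η ω + t * if ω = ω₀ then 1 else 0) η
          ≤ ∑ ω, (t * η ω + t * if ω = ω₀ then 1 else 0) := by
            refine Finset.sum_le_sum fun ω _ => ?_
            have := mul_nonneg ht0 (hη.1 ω)
            dsimp only
            rw [abs_le]
            split_ifs <;> constructor <;> linarith
        _ = 2 * t := by
            rw [Finset.sum_add_distrib, ← Finset.mul_sum, ← Finset.mul_sum, hη.2]
            simp
            ring
  rcases le_or_gt 2 D with h | h
  · have := key 1 zero_le_one le_rfl (by linarith)
    have h1 : 0 ≤ g ω₀ := by linarith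
    have := mul_nonneg hD.le h1
    exact ⟨by linarith, fun h' => absurd h1 (not_le.2 h')⟩
  · have := key (D / 2) (by linarith) (by linarith) (by linarith)
    have := mul_nonneg hD.le hη0
    exact ⟨by nlinarith, fun _ => h⟩

theorem Val_nonneg {Ω A : Type*} [Fintype Ω] [Fintype A] {v : Ω → A → ℝ} {μ : Ω → ℝ}
    {σ : Ω → A → ℝ} (hv : ∀ ω a, v ω a ∈ Set.Icc (0 : ℝ) 1) (hμ : IsDist μ) (hσ : IsMech σ) :
    0 ≤ Val v μ σ :=
  Finset.sum_nonneg fun ω _ => Finset.sum_nonneg fun a _ =>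
    mul_nonneg (mul_nonneg (hμ.1 ω) ((hσ ω).1 a)) (hv ω a).1

theorem Val_le_one {Ω A : Type*} [Fintype Ω] [Fintype A] {v : Ω → A → ℝ} {μ : Ω → ℝ}
    {σ : Ω → A → ℝ} (hv : ∀ ω a, v ω a ∈ Set.Icc (0 : ℝ) 1) (hμ : IsDist μ) (hσ : IsMech σ) :
    Val v μ σ ≤ 1 := by
  have h : Val v μ σ ≤ ∑ ω, ∑ a, μ ω * σ ω a :=
    Finset.sum_le_sum fun ω _ => Finset.sum_le_sum fun a _ =>
      mul_le_of_le_one_right (mul_nonneg (hμ.1 ω) ((hσ ω).1 a)) (hv ω a).2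
  refine h.trans_eq ?_
  simp only [← Finset.mul_sum, (hσ _).2, mul_one, hμ.2]

/-- Revealing the state yields a mechanism persuasive for every (unnormalized) prior. -/
theorem exists_isMech_forall_pers {Ω A : Type*} [Fintype Ω] [Fintype A] [Nonempty A]
    (u : Ω → A → ℝ) : ∃ σ : Ω → A → ℝ, IsMech σ ∧ ∀ μ : Ω → ℝ, (∀ ω, 0 ≤ μ ω) → Pers u μ σ := by
  classical
  choose best hbest using fun ω => Finite.exists_max (u ω)
  refine ⟨fun ω a => if a = best ω then 1 else 0, fun ω => ⟨fun a => ?_, by simp⟩, ?_⟩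
  · dsimp only
    split_ifs <;> norm_num
  · intro μ hμ a a'
    refine Finset.sum_nonneg fun ω _ => ?_
    dsimp only
    split_ifs with h
    · have := hbest ω a'
      rw [← h] at this
      exact mul_nonneg (by simpa using hμ ω) (sub_nonneg.2 this)
    · simp

theorem isCompact_setOf_isMech_and_pers {Ω A : Type*} [Fintype Ω] [Fintype A]
    (u : Ω → A → ℝ) (μ : Ω → ℝ) : IsCompact {σ : Ω → A → ℝ | IsMech σ ∧ Pers u μ σ} := by
  have h1 : IsCompact {σ : Ω → A → ℝ | IsMech σ} := by
    have : {σ : Ω → A → ℝ | IsMech σ} = Set.univ.pi fun _ => stdSimplex ℝ A := by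
      ext σ
      simp [IsMech, IsDist, stdSimplex, Set.mem_pi]
    rw [this]
    exact isCompact_univ_pi fun _ => isCompact_stdSimplex ℝ A
  refine h1.inter_right (t := {σ | Pers u μ σ}) ?_
  simp only [Pers, Set.ofPred_forall]
  exact isClosed_iInter fun a => isClosed_iInter fun a' =>
    isClosed_le continuous_const (by fun_prop)

theorem exists_Val_eq_OPT {Ω A : Type*} [Fintype Ω] [Fintype A] [Nonempty A]
    (u v : Ω → A → ℝ) {μ : Ω → ℝ} (hμ : IsDist μ) :
    ∃ σ, IsMech σ ∧ Pers u μ σ ∧ Val v μ σ = OPT u v μ := by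
  obtain ⟨τ, hτ, hτp⟩ := exists_isMech_forall_pers u
  have hcont : Continuous (Val v μ) := by
    unfold Val
    fun_prop
  obtain ⟨σ, hσ, h⟩ := ((isCompact_setOf_isMech_and_pers u μ).image hcont).sSup_mem
    ⟨_, τ, ⟨hτ, hτp μ hμ.1⟩, rfl⟩
  exact ⟨σ, hσ.1, hσ.2, h⟩

/-- If a nonnegative measure `y` puts enough weight on the linear functional `g`, reweighting `y`
by factors within `[1 - e, 1 + e]` keeps `g` nonnegative. -/
theorem sum_mul_mul_nonneg_of_abs_sub_one_le {Ω : Type*} [Fintype Ω] {r y g : Ω → ℝ}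
    {e m w s : ℝ} (hr : ∀ ω, |r ω - 1| ≤ e) (hy : ∀ ω, 0 ≤ y ω) (hg : ∀ ω, -m ≤ g ω)
    (hm : 0 ≤ m) (he0 : 0 ≤ e) (he : e ≤ 1 / 2) (hyw : ∑ ω, y ω ≤ w) (hw : 0 ≤ w)
    (hs : 4 * e ≤ s) (hyg : s * w * m ≤ ∑ ω, y ω * g ω) :
    0 ≤ ∑ ω, r ω * y ω * g ω := by
  have h1 : (1 - e) * (∑ ω, y ω * g ω) - 2 * e * m * ∑ ω, y ω ≤ ∑ ω, r ω * y ω * g ω := by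
    rw [Finset.mul_sum, Finset.mul_sum, ← Finset.sum_sub_distrib]
    refine Finset.sum_le_sum fun ω _ => ?_
    obtain ⟨h2, h3⟩ := abs_le.1 (hr ω)
    have h4 := mul_nonneg (mul_nonneg (by linarith : 0 ≤ r ω - (1 - e)) (hy ω))
      (by linarith [hg ω] : 0 ≤ g ω + m)
    have h5 := mul_nonneg (mul_nonneg (by linarith : 0 ≤ 1 + e - r ω) (hy ω)) hm
    linarith
  have hwm := mul_nonneg hw hm
  have h2 : 4 * e * (w * m) ≤ ∑ ω, y ω * g ω :=
    (mul_le_mul_of_nonneg_right hs hwm).trans (by linarith)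
  have h3 : (1 - e) * (4 * e * (w * m)) ≤ (1 - e) * ∑ ω, y ω * g ω :=
    mul_le_mul_of_nonneg_left h2 (by linarith)
  have h4 : 2 * e * m * (∑ ω, y ω) ≤ 2 * e * m * w :=
    mul_le_mul_of_nonneg_left hyw (by positivity)
  have h5 : 0 ≤ (1 - 2 * e) * (e * (w * m)) :=
    mul_nonneg (by linarith) (mul_nonneg he0 hwm)
  linarith

/-- Mixing a persuasive mechanism with signals inducing the interior beliefs `η a`, and revealing
the state with the remaining probability, yields a robustly persuasive mechanism. -/
theorem exists_persOn_ball1_of_le_one {Ω A : Type*} [Fintype Ω] [Fintype A] [Nonempty Ω]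
    [Nonempty A] {u v : Ω → A → ℝ} (hv : ∀ ω a, v ω a ∈ Set.Icc (0 : ℝ) 1) {D : ℝ} (hD : 0 < D)
    (hreg : ∀ a : A, ∃ η : Ω → ℝ, η ∈ Popt u a ∧ ball1 η D ⊆ Popt u a) {p0 : ℝ} (hp0 : 0 < p0)
    {μ : Ω → ℝ} (hμ : IsDist μ) (hμp : ∀ ω, p0 ≤ μ ω) {ε : ℝ} (hε : 0 ≤ ε)
    (hδ : 4 * ε / (p0 ^ 2 * D) ≤ 1) {σ : Ω → A → ℝ} (hσ : IsMech σ) (hσp : Pers u μ σ) :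
    ∃ τ : Ω → A → ℝ, IsMech τ ∧ PersOn u (ball1 μ ε) τ ∧
      (1 - 4 * ε / (p0 ^ 2 * D)) * Val v μ σ ≤ Val v μ τ := by
  choose η hη hball using hreg
  obtain ⟨ρ, hρ, hρp⟩ := exists_isMech_forall_pers u
  set δ := 4 * ε / (p0 ^ 2 * D) with hδdef
  have hδ0 : 0 ≤ δ := by positivity
  have hp1 : p0 ≤ 1 := (hμp (Classical.arbitrary Ω)).trans (hμ.le_one _)
  have hμpos : ∀ ω, 0 < μ ω := fun ω => hp0.trans_le (hμp ω)
  set w : A → ℝ := fun a => ∑ ω, μ ω * σ ω a with hwdef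
  have hw0 : ∀ a, 0 ≤ w a := fun a =>
    Finset.sum_nonneg fun ω _ => mul_nonneg (hμ.1 ω) ((hσ ω).1 a)
  have hw1 : ∑ a, w a = 1 := by
    rw [hwdef, Finset.sum_comm]
    simp only [← Finset.mul_sum, (hσ _).2, mul_one, hμ.2]
  set S : Ω → ℝ := fun ω => ∑ a, w a * η a ω with hSdef
  have hS1 : ∀ ω, S ω ≤ 1 := fun ω => hw1 ▸ Finset.sum_le_sum fun a _ =>
    mul_le_of_le_one_right (hw0 a) ((hη a).1.le_one ω)
  set c : Ω → ℝ := fun ω => δ * (1 - p0 * S ω / μ ω) with hcdef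
  have hc0 : ∀ ω, 0 ≤ c ω := fun ω => by
    refine mul_nonneg hδ0 (sub_nonneg.2 ((div_le_one (hμpos ω)).2 ?_))
    nlinarith [hS1 ω, hμp ω]
  set q : Ω → A → ℝ := fun ω a => δ * (p0 * (w a * η a ω)) with hqdef
  have hq0 : ∀ ω a, 0 ≤ q ω a := fun ω a =>
    mul_nonneg hδ0 (mul_nonneg hp0.le (mul_nonneg (hw0 a) ((hη a).1.1 ω)))
  have hextra : ∀ ω a, 0 ≤ q ω a / μ ω + c ω * ρ ω a := fun ω a =>
    add_nonneg (div_nonneg (hq0 ω a) (hμ.1 ω)) (mul_nonneg (hc0 ω) ((hρ ω).1 a))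
  refine ⟨fun ω a => (1 - δ) * σ ω a + (q ω a / μ ω + c ω * ρ ω a), fun ω => ⟨fun a => ?_, ?_⟩,
    ?_, ?_⟩
  · exact add_nonneg (mul_nonneg (sub_nonneg.2 hδ) ((hσ ω).1 a)) (hextra ω a)
  · have hqs : ∑ a, q ω a = δ * (p0 * S ω) := by simp only [hqdef, hSdef, Finset.mul_sum]
    rw [Finset.sum_add_distrib, Finset.sum_add_distrib, ← Finset.mul_sum, ← Finset.mul_sum,
      ← Finset.sum_div, (hσ ω).2, (hρ ω).2, hqs, hcdef]
    ring
  · rintro ν ⟨hν, hνε⟩ a a'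
    set g : Ω → ℝ := fun ω => u ω a - u ω a' with hgdef
    set y : Ω → ℝ := fun ω => (1 - δ) * (μ ω * σ ω a) + q ω a with hydef
    have hy0 : ∀ ω, 0 ≤ y ω := fun ω =>
      add_nonneg (mul_nonneg (sub_nonneg.2 hδ) (mul_nonneg (hμ.1 ω) ((hσ ω).1 a))) (hq0 ω a)
    have hsplit : ∑ ω, ν ω * ((1 - δ) * σ ω a + (q ω a / μ ω + c ω * ρ ω a)) * g ω
        = ∑ ω, ν ω / μ ω * y ω * g ω + ∑ ω, (ν ω * c ω) * ρ ω a * g ω := by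
      rw [← Finset.sum_add_distrib]
      refine Finset.sum_congr rfl fun ω _ => ?_
      have := (hμpos ω).ne'
      simp only [hydef]
      field_simp
      ring
    refine le_of_le_of_eq (add_nonneg ?_ (hρp (fun ω => ν ω * c ω)
      (fun ω => mul_nonneg (hν.1 ω) (hc0 ω)) a a')) hsplit.symm
    obtain ⟨ω₀, hω₀⟩ := Finite.exists_min g
    rcases le_or_gt 0 (g ω₀) with hpos | hneg
    · exact Finset.sum_nonneg fun ω _ =>
        mul_nonneg (mul_nonneg (div_nonneg (hν.1 ω) (hμ.1 ω)) (hy0 ω)) (hpos.trans (hω₀ ω))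
    obtain ⟨hηg, hD2⟩ := neg_mul_le_sum_of_nonneg_on_ball1 (hη a).1 hD (g := g)
      (fun κ hκ => by
        have := (hball a hκ).2 a'
        simp only [hgdef, mul_sub, Finset.sum_sub_distrib]
        linarith) ω₀
    have hε4 : 4 * ε ≤ p0 ^ 2 * D := by rwa [hδdef, div_le_one (by positivity)] at hδ
    have hδe : δ * p0 * (D / 2) = 4 * (ε / (2 * p0)) := by
      rw [hδdef]
      field_simp
    refine sum_mul_mul_nonneg_of_abs_sub_one_le (e := ε / (2 * p0)) (m := -g ω₀) (w := w a)
      (s := δ * p0 * (D / 2)) (fun ω => ?_) hy0 (fun ω => by linarith [hω₀ ω]) (by linarith)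
      (by positivity) ?_ ?_ (hw0 a) hδe.ge ?_
    · rw [div_sub_one (hμpos ω).ne', abs_div, abs_of_pos (hμpos ω), ← div_div]
      exact div_le_div₀ (by linarith) ((hμ.abs_sub_le hν ω).trans (by linarith)) hp0 (hμp ω)
    · rw [div_le_div_iff₀ (by positivity) two_pos]
      nlinarith [hD2 hneg, mul_pos hp0 hp0]
    · have : ∑ ω, y ω = (1 - δ) * w a + δ * (p0 * w a) := by
        simp only [hydef, hqdef, Finset.sum_add_distrib, ← Finset.mul_sum, (hη a).1.2, mul_one,
          hwdef]
      rw [this]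
      nlinarith [mul_nonneg (mul_nonneg hδ0 (hw0 a)) (sub_nonneg.2 hp1)]
    · have hyg : ∑ ω, y ω * g ω = (1 - δ) * (∑ ω, μ ω * σ ω a * g ω)
          + δ * p0 * w a * ∑ ω, η a ω * g ω := by
        rw [Finset.mul_sum, Finset.mul_sum, ← Finset.sum_add_distrib]
        refine Finset.sum_congr rfl fun ω _ => ?_
        simp only [hydef, hqdef]
        ring
      have h1 := mul_nonneg (sub_nonneg.2 hδ) (hσp a a')
      have h2 := mul_le_mul_of_nonneg_left hηg (mul_nonneg (mul_nonneg hδ0 hp0.le) (hw0 a))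
      rw [hyg]
      linarith
  · simp only [Val, Finset.mul_sum]
    refine Finset.sum_le_sum fun ω _ => Finset.sum_le_sum fun a _ => ?_
    have := mul_nonneg (mul_nonneg (hμ.1 ω) (hextra ω a)) (hv ω a).1
    linarith

/-- Existence of a near-optimal robustly persuasive mechanism (multiplicative form of
Proposition 1): under regularity with constant `D`, for a fully supported prior `μ`
(`min_ω μ(ω) ≥ p0`) and `ε ≥ 0`, the best sender value over mechanisms persuasive on the
whole ball `B₁(μ, ε)` is at least `(1 − 4ε/(p0² D))·OPT(μ)`; equivalently, some mechanism
persuasive on the ball attains at least this fraction of the optimum. -/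
theorem stmt17 {Ω A : Type*} [Fintype Ω] [Fintype A]
    (hΩ : 2 ≤ Fintype.card Ω) (hA : 2 ≤ Fintype.card A)
    (u : Ω → A → ℝ) (v : Ω → A → ℝ) (hv : ∀ ω a, v ω a ∈ Set.Icc (0 : ℝ) 1)
    (D : ℝ) (hD : 0 < D)
    (hreg : ∀ a : A, ∃ η : Ω → ℝ, η ∈ Popt u a ∧ ball1 η D ⊆ Popt u a)
    (p0 : ℝ) (hp0 : 0 < p0)
    (μ : Ω → ℝ) (hμ : IsDist μ) (hμp : ∀ ω, p0 ≤ μ ω)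
    (ε : ℝ) (hε : 0 ≤ ε) :
    (1 - 4 * ε / (p0 ^ 2 * D)) * OPT u v μ ≤ OPTRobust u v μ (ball1 μ ε)
    ∧ ∃ σ : Ω → A → ℝ, IsMech σ ∧ PersOn u (ball1 μ ε) σ ∧
        (1 - 4 * ε / (p0 ^ 2 * D)) * OPT u v μ ≤ Val v μ σ := by
  have : Nonempty Ω := Fintype.card_pos_iff.1 (by lia)
  have : Nonempty A := Fintype.card_pos_iff.1 (by lia)
  obtain ⟨σ, hσ, hσp, hσv⟩ := exists_Val_eq_OPT u v hμ
  have hmain : ∃ τ : Ω → A → ℝ, IsMech τ ∧ PersOn u (ball1 μ ε) τ ∧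
      (1 - 4 * ε / (p0 ^ 2 * D)) * OPT u v μ ≤ Val v μ τ := by
    rw [← hσv]
    rcases le_or_gt (4 * ε / (p0 ^ 2 * D)) 1 with hδ | hδ
    · exact exists_persOn_ball1_of_le_one hv hD hreg hp0 hμ hμp hε hδ hσ hσp
    · obtain ⟨τ, hτ, hτp⟩ := exists_isMech_forall_pers u
      exact ⟨τ, hτ, fun ν hν => hτp ν hν.1.1,
        (mul_nonpos_of_nonpos_of_nonneg (by linarith) (Val_nonneg hv hμ hσ)).trans
          (Val_nonneg hv hμ hτ)⟩
  refine ⟨?_, hmain⟩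
  obtain ⟨τ, hτ, hτp, hτv⟩ := hmain
  refine hτv.trans (le_csSup ⟨1, ?_⟩ ⟨τ, ⟨hτ, hτp⟩, rfl⟩)
  rintro _ ⟨κ, hκ, rfl⟩
  exact Val_le_one hv hμ hκ.1
end

section
/- Indistinguishability of the perturbed priors (Pinsker step in the lower bound): let Ω = {ω0, ω1, ω2}, let p0 ∈ (0, 1/3], and let 0 < ε < (1−p0)/2. Define μ̄0 := (p0, (1−p0)/2, (1−p0)/2) and μ̄1 := (p0, (1−p0+ε)/2, (1−p0−ε)/2). Then for every T ≥ 1 and every event E ⊆ Ω^T, | μ̄0^{⊗T}(E) − μ̄1^{⊗T}(E) | ≤ ε·√(T/2), where μ^{⊗T} denotes the T-fold product (i.i.d.) measure on Ω^T. -/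
/-- **Le Cam's inequality** on a finite type, for distributions given by amplitudes `f`, `g`:
the difference of the probabilities of `E` is controlled by the Bhattacharyya coefficient. -/
lemma sq_sum_indicator_sq_sub_le {ι : Type*} [Fintype ι] (f g : ι → ℝ)
    (hf : ∑ x, f x ^ 2 = 1) (hg : ∑ x, g x ^ 2 = 1) (E : Set ι) :
    (∑ x, E.indicator (fun y => f y ^ 2) x - ∑ x, E.indicator (fun y => g y ^ 2) x) ^ 2
      ≤ 1 - (∑ x, f x * g x) ^ 2 := by
  classical
  set s : ι → ℝ := fun x => if x ∈ E then 1 else -1 with hs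
  have hs2 : ∀ x, s x ^ 2 = 1 := fun x => by simp only [hs]; split_ifs <;> norm_num
  have hD : 2 * (∑ x, E.indicator (fun y => f y ^ 2) x - ∑ x, E.indicator (fun y => g y ^ 2) x)
      = ∑ x, s x * (f x - g x) * (f x + g x) := by
    have h0 : ∑ x, (f x ^ 2 - g x ^ 2) = 0 := by
      rw [Finset.sum_sub_distrib, hf, hg, sub_self]
    rw [← Finset.sum_sub_distrib, Finset.mul_sum, ← sub_zero (∑ x, _), ← h0,
      ← Finset.sum_sub_distrib]
    refine Finset.sum_congr rfl fun x _ => ?_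
    by_cases hx : x ∈ E <;> simp [hs, hx] <;> ring
  have hcs := Finset.sum_mul_sq_le_sq_mul_sq Finset.univ
    (fun x => s x * (f x - g x)) (fun x => f x + g x)
  have hminus : ∑ x, (s x * (f x - g x)) ^ 2 = 2 - 2 * ∑ x, f x * g x := by
    have : ∀ x, (s x * (f x - g x)) ^ 2 = f x ^ 2 + g x ^ 2 - 2 * (f x * g x) := fun x => by
      rw [mul_pow, hs2]; ring
    simp only [this, Finset.sum_sub_distrib, Finset.sum_add_distrib, ← Finset.mul_sum, hf, hg]
    ring
  have hplus : ∑ x, (f x + g x) ^ 2 = 2 + 2 * ∑ x, f x * g x := by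
    have : ∀ x, (f x + g x) ^ 2 = f x ^ 2 + g x ^ 2 + 2 * (f x * g x) := fun x => by ring
    simp only [this, Finset.sum_add_distrib, ← Finset.mul_sum, hf, hg]
    ring
  rw [← hD, hminus, hplus] at hcs
  nlinarith

/-- Le Cam's inequality for i.i.d. samples: the squared difference of the probabilities of an
event grows at most linearly in the number of samples. -/
lemma sq_prodProb_sub_le {Ω : Type*} [Fintype Ω] {T : ℕ} (μ ν : Ω → ℝ)
    (hμ0 : ∀ ω, 0 ≤ μ ω) (hν0 : ∀ ω, 0 ≤ ν ω) (hμ : ∑ ω, μ ω = 1) (hν : ∑ ω, ν ω = 1)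
    (E : Set (Fin T → Ω)) :
    (prodProb μ E - prodProb ν E) ^ 2 ≤ T * (1 - (∑ ω, √(μ ω) * √(ν ω)) ^ 2) := by
  have hsq : ∀ ρ : Ω → ℝ, (∀ ω, 0 ≤ ρ ω) → ∀ x : Fin T → Ω,
      (∏ t, √(ρ (x t))) ^ 2 = ∏ t, ρ (x t) := fun ρ hρ x => by
    rw [← Finset.prod_pow]
    exact Finset.prod_congr rfl fun t _ => Real.sq_sqrt (hρ _)
  have hsum : ∀ ρ : Ω → ℝ, (∀ ω, 0 ≤ ρ ω) → ∑ ω, ρ ω = 1 →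
      ∑ x : Fin T → Ω, (∏ t, √(ρ (x t))) ^ 2 = 1 := fun ρ hρ h => by
    simp only [hsq ρ hρ]
    rw [← Fintype.sum_pow, h, one_pow]
  have hBC : ∑ x : Fin T → Ω, (∏ t, √(μ (x t))) * ∏ t, √(ν (x t))
      = (∑ ω, √(μ ω) * √(ν ω)) ^ T := by
    simp only [← Finset.prod_mul_distrib]
    rw [Fintype.sum_pow (fun ω => √(μ ω) * √(ν ω))]
  have key := sq_sum_indicator_sq_sub_le _ _ (hsum μ hμ0 hμ) (hsum ν hν0 hν) E
  simp only [hsq μ hμ0, hsq ν hν0, hBC] at key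
  have hbern := one_add_mul_le_pow
    (a := (∑ ω, √(μ ω) * √(ν ω)) ^ 2 - 1) (by nlinarith [sq_nonneg (∑ ω, √(μ ω) * √(ν ω))]) T
  rw [add_sub_cancel, pow_right_comm] at hbern
  unfold prodProb
  linarith

lemma two_sub_sq_div_three_le_sqrt_add_sqrt {d : ℝ} (hd : d ^ 2 ≤ 1 / 4) :
    2 - d ^ 2 / 3 ≤ √(1 + d) + √(1 - d) := by
  have h1 : 0 ≤ 1 + d := by nlinarith
  have h2 : 0 ≤ 1 - d := by nlinarith
  have hu : 1 - 2 * d ^ 2 / 3 + d ^ 4 / 18 ≤ √(1 + d) * √(1 - d) := by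
    rw [← Real.sqrt_mul h1]
    apply Real.le_sqrt_of_sq_le
    obtain ⟨q, hq⟩ : ∃ q, q = d ^ 2 := ⟨_, rfl⟩
    have hq0 : 0 ≤ q := hq ▸ sq_nonneg d
    have h4 : d ^ 4 = q ^ 2 := by rw [hq]; ring
    have hr : (1 + d) * (1 - d) = 1 - q := by rw [hq]; ring
    rw [h4, hr, ← hq]
    rw [← hq] at hd
    have : 0 ≤ q * (1 / 3 - 5 / 9 * q) := mul_nonneg hq0 (by linarith)
    have : 0 ≤ q ^ 3 * (2 / 27 - q / 324) := mul_nonneg (pow_nonneg hq0 3) (by linarith)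
    nlinarith
  refine (abs_le_of_sq_le_sq' ?_ (by positivity)).2
  nlinarith [Real.sq_sqrt h1, Real.sq_sqrt h2]

/-- Indistinguishability of the perturbed priors (Pinsker step in the lower bound): for
`μ̄0 = (p0, (1−p0)/2, (1−p0)/2)` and `μ̄1 = (p0, (1−p0+ε)/2, (1−p0−ε)/2)` with
`0 < ε < (1−p0)/2`, the T-fold product measures differ on any event by at most `ε·√(T/2)`. -/
theorem stmt18 (p0 ε : ℝ) (hp0 : 0 < p0) (hp03 : p0 ≤ 1 / 3)
    (hε : 0 < ε) (hε2 : ε < (1 - p0) / 2)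
    (T : ℕ) (hT : 1 ≤ T) (E : Set (Fin T → Fin 3)) :
    |prodProb ![p0, (1 - p0) / 2, (1 - p0) / 2] E
      - prodProb ![p0, (1 - p0 + ε) / 2, (1 - p0 - ε) / 2] E|
      ≤ ε * Real.sqrt ((T : ℝ) / 2) := by
  have key := sq_prodProb_sub_le ![p0, (1 - p0) / 2, (1 - p0) / 2]
    ![p0, (1 - p0 + ε) / 2, (1 - p0 - ε) / 2]
    (by intro ω; fin_cases ω <;> simp <;> linarith)
    (by intro ω; fin_cases ω <;> simp <;> linarith)
    (by simp [Fin.sum_univ_three]; ring) (by simp [Fin.sum_univ_three]; ring) E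
  set B := ∑ ω, √((![p0, (1 - p0) / 2, (1 - p0) / 2] : Fin 3 → ℝ) ω) *
    √((![p0, (1 - p0 + ε) / 2, (1 - p0 - ε) / 2] : Fin 3 → ℝ) ω) with hB
  obtain ⟨a, ha⟩ : ∃ a, a = (1 - p0) / 2 := ⟨_, rfl⟩
  obtain ⟨d, hd⟩ : ∃ d, d = ε / (1 - p0) := ⟨_, rfl⟩
  have ha0 : 0 ≤ a := by linarith
  have hεd : ε = 2 * a * d := by
    rw [hd, ha]; field_simp [show 1 - p0 ≠ 0 by linarith]
  have hBeq : B = p0 + a * (√(1 + d) + √(1 - d)) := by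
    have e1 : (1 - p0 + ε) / 2 = a * (1 + d) := by linarith
    have e2 : (1 - p0 - ε) / 2 = a * (1 - d) := by linarith
    rw [hB, e1, e2, ← ha]
    simp only [Fin.sum_univ_three, Matrix.cons_val]
    rw [Real.sqrt_mul ha0, Real.sqrt_mul ha0, ← mul_assoc, ← mul_assoc,
      Real.mul_self_sqrt hp0.le, Real.mul_self_sqrt ha0]
    ring
  have hd0 : 0 ≤ d := hd ▸ div_nonneg hε.le (by linarith)
  have hd2 : d ≤ 1 / 2 := by
    rw [hd, div_le_iff₀ (by linarith)]; linarith
  have hs := two_sub_sq_div_three_le_sqrt_add_sqrt (d := d) (by nlinarith)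
  have hB1 : 1 - a * d ^ 2 / 3 ≤ B := by
    rw [hBeq]; nlinarith [mul_le_mul_of_nonneg_left hs ha0]
  have hfinal : 1 - B ^ 2 ≤ ε ^ 2 / 2 := by
    have h3 : 0 ≤ a * d ^ 2 * (a - 1 / 3) :=
      mul_nonneg (mul_nonneg ha0 (sq_nonneg d)) (by linarith)
    rw [hεd]
    nlinarith [sq_nonneg (1 - B)]
  refine abs_le_of_sq_le_sq ?_ (by positivity)
  rw [mul_pow, Real.sq_sqrt (by positivity)]
  calc _ ≤ _ := key
    _ ≤ T * (ε ^ 2 / 2) := by gcongr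
    _ = _ := by ring
end
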